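/- arXiv:1007.5265 — 2 statements merged into one kernel-verified Lean document; each statement's English description precedes it below -/
import Mathlib

section
/- Let R be an integral domain, * a star operation on R, and I a nonzero ideal of R that is Clifford *-regular. Set E := (I^* : I^*) and T := I^*(E : I^*). Then T is v_E-invertible, that is, (E : (E : T)) = E. -/
open scoped Pointwise

section Defs

variable (A K : Type*) [CommRing A] [Field K] [Algebra A K]

/-- `I` is a nonzero fractional ideal of `A` (inside `K`):
`I ≠ 0` and `dI ⊆ A` for some nonzero `d ∈ A`. -/
def IsFrac (I : Submodule A K) : Prop :=
  I ≠ ⊥ ∧ ∃ d : A, d ≠ 0 ∧ ∀ x ∈ I, ∃ a : A, algebraMap A K d * x = algebraMap A K a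

/-- The divisorial closure `I^v = (A : (A : I))`; here `(J : I) = J / I` and
`(1 : Submodule A K)` is the image of `A` in `K`. -/
def vS (I : Submodule A K) : Submodule A K := 1 / (1 / I)

/-- The `t`-operation `I^t = ⋃ {J^v : J ⊆ I nonzero finitely generated}` (a directed union,
hence equal to the supremum of submodules). -/
def tS (I : Submodule A K) : Submodule A K :=
  ⨆ J ∈ {J : Submodule A K | J ≠ ⊥ ∧ J.FG ∧ J ≤ I}, vS A K J

/-- The image of an integral ideal of `A` in `K`. -/
def idealK (I : Ideal A) : Submodule A K := Submodule.map (Algebra.linearMap A K) I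

/-- A nonzero (fractional) ideal `I` is stable if `I((I:I):I) = (I:I)`. -/
def IsStableIdeal (I : Submodule A K) : Prop := I * ((I / I) / I) = I / I

/-- `A` is a stable domain: every nonzero (fractional) ideal is stable. -/
def StableDomain : Prop := ∀ I : Submodule A K, IsFrac A K I → IsStableIdeal A K I

/-- `A` is Clifford regular: every nonzero (fractional) ideal `I` satisfies `I = I²J`
for some nonzero `A`-submodule `J` of `K`. -/
def CliffordRegularDomain : Prop :=
  ∀ I : Submodule A K, IsFrac A K I → ∃ J : Submodule A K, J ≠ ⊥ ∧ I = I * I * J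

end Defs
section Star

variable (R K : Type*) [CommRing R] [IsDomain R] [Field K] [Algebra R K] [IsFractionRing R K]

/-- A star operation on the domain `R` with quotient field `K`: a map on (nonzero)
fractional ideals satisfying `(aI)^* = aI^*`, `R^* = R`, `I ⊆ I^*`, monotonicity and
idempotency. -/
structure StarOperation : Type _ where
  star : Submodule R K → Submodule R K
  star_frac : ∀ I, IsFrac R K I → IsFrac R K (star I)
  star_smul : ∀ (a : K), a ≠ 0 → ∀ I, IsFrac R K I → star (a • I) = a • star I
  star_one : star (1 : Submodule R K) = 1
  le_star : ∀ I, IsFrac R K I → I ≤ star I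
  star_mono : ∀ I J, IsFrac R K I → IsFrac R K J → I ≤ J → star I ≤ star J
  star_star : ∀ I, IsFrac R K I → star (star I) = star I

variable {R K}

/-- `*` is of finite type: `I^* = ⋃ {J^* : J ⊆ I nonzero finitely generated}`. -/
def StarOperation.FiniteType (s : StarOperation R K) : Prop :=
  ∀ I, IsFrac R K I →
    s.star I = ⨆ J ∈ {J : Submodule R K | J ≠ ⊥ ∧ J.FG ∧ J ≤ I}, s.star J

/-- `I` is `*`-stable: with `E := (I^* : I^*)`, one has `(I^*(E : I^*))^* = E`. -/
def StarOperation.Stable (s : StarOperation R K) (I : Submodule R K) : Prop :=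
  s.star (s.star I * ((s.star I / s.star I) / s.star I)) = s.star I / s.star I

/-- `I` is Clifford `*`-regular: `I^* = (I²J)^*` for some nonzero ideal `J`. -/
def StarOperation.Regular (s : StarOperation R K) (I : Submodule R K) : Prop :=
  ∃ J : Submodule R K, IsFrac R K J ∧ s.star I = s.star (I * I * J)

/-- `I` is Boole `*`-regular: `(I²)^* = xI^*` for some nonzero `x ∈ K`. -/
def StarOperation.BooleRegular (s : StarOperation R K) (I : Submodule R K) : Prop :=
  ∃ x : K, x ≠ 0 ∧ s.star (I * I) = x • s.star I

/-- `I` is strongly `*`-stable: `I^* = xE` for some nonzero `x ∈ K`, where `E = (I^* : I^*)`. -/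
def StarOperation.StronglyStable (s : StarOperation R K) (I : Submodule R K) : Prop :=
  ∃ x : K, x ≠ 0 ∧ s.star I = x • (s.star I / s.star I)

end Star

theorem IsFrac.mul {R K : Type*} [CommRing R] [IsDomain R] [Field K] [Algebra R K]
    {I J : Submodule R K} (hI : IsFrac R K I) (hJ : IsFrac R K J) : IsFrac R K (I * J) := by
  obtain ⟨hI0, d, hd, hdI⟩ := hI
  obtain ⟨hJ0, e, he, heJ⟩ := hJ
  refine ⟨?_, d * e, mul_ne_zero hd he, fun x hx => ?_⟩
  · obtain ⟨x, hx, hx0⟩ := Submodule.exists_mem_ne_zero_of_ne_bot hI0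
    obtain ⟨y, hy, hy0⟩ := Submodule.exists_mem_ne_zero_of_ne_bot hJ0
    exact (Submodule.ne_bot_iff _).2
      ⟨x * y, Submodule.mul_mem_mul hx hy, mul_ne_zero hx0 hy0⟩
  · induction hx using Submodule.mul_induction_on' with
    | mem_mul_mem x hx y hy =>
      obtain ⟨a, ha⟩ := hdI x hx
      obtain ⟨b, hb⟩ := heJ y hy
      refine ⟨a * b, ?_⟩
      rw [map_mul, map_mul, ← ha, ← hb]
      ring
    | add x _ y _ hx hy =>
      obtain ⟨a, ha⟩ := hx
      obtain ⟨b, hb⟩ := hy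
      exact ⟨a + b, by rw [map_add, ← ha, ← hb, mul_add]⟩

theorem IsFrac.smul {R K : Type*} [CommRing R] [IsDomain R] [Field K] [Algebra R K]
    [IsFractionRing R K] {I : Submodule R K} (hI : IsFrac R K I) {x : K} (hx : x ≠ 0) :
    IsFrac R K (x • I) := by
  obtain ⟨hI0, d, hd, hdI⟩ := hI
  obtain ⟨a, b, hb, rfl⟩ := IsFractionRing.div_surjective (A := R) x
  have hb0 : algebraMap R K b ≠ 0 := IsFractionRing.to_map_ne_zero_of_mem_nonZeroDivisors hb
  refine ⟨?_, b * d, mul_ne_zero (nonZeroDivisors.ne_zero hb) hd, fun z hz => ?_⟩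
  · obtain ⟨y, hy, hy0⟩ := Submodule.exists_mem_ne_zero_of_ne_bot hI0
    exact (Submodule.ne_bot_iff _).2
      ⟨_, Submodule.smul_mem_pointwise_smul y _ I hy, mul_ne_zero hx hy0⟩
  · obtain ⟨y, hy, rfl⟩ := (Submodule.mem_smul_pointwise_iff_exists _ _ _).1 hz
    obtain ⟨c, hc⟩ := hdI y hy
    refine ⟨a * c, ?_⟩
    rw [map_mul, map_mul, ← hc, smul_eq_mul]
    field_simp

/-- Conductors into a `*`-closed ideal do not see the difference between `N` and `N^*`. -/
theorem StarOperation.star_div_star {R K : Type*} [CommRing R] [IsDomain R] [Field K] [Algebra R K]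
    [IsFractionRing R K] (s : StarOperation R K) {N M : Submodule R K} (hN : IsFrac R K N)
    (hM : IsFrac R K M) : s.star M / s.star N = s.star M / N := by
  refine le_antisymm (fun x hx => ?_) (fun x hx => ?_) <;>
    rw [Submodule.mem_div_iff_forall_mul_mem] at *
  · exact fun y hy => hx y (s.le_star N hN hy)
  · intro y hy
    rcases eq_or_ne x 0 with rfl | hx0
    · simp
    have hle : x • N ≤ s.star M := by
      intro z hz
      obtain ⟨y, hy, rfl⟩ := (Submodule.mem_smul_pointwise_iff_exists _ _ _).1 hz
      exact hx y hy
    have h := s.star_mono _ _ (hN.smul hx0) (s.star_frac M hM) hle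
    rw [s.star_star M hM, s.star_smul x hx0 N hN] at h
    exact h (Submodule.smul_mem_pointwise_smul y x _ hy)

theorem Submodule.div_self_div_self {R K : Type*} [CommRing R] [Field K] [Algebra R K]
    (L : Submodule R K) : (L / L) / (L / L) = L / L := by
  have h1 : (1 : K) ∈ L / L := Submodule.mem_div_iff_forall_mul_mem.2 fun y hy => by simpa
  refine le_antisymm (fun x hx => ?_) (Submodule.le_div_iff_mul_le.2 ?_)
  · simpa using Submodule.mem_div_iff_forall_mul_mem.1 hx 1 h1
  · rw [Submodule.le_div_iff_mul_le, mul_assoc]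
    have h : L / L * L ≤ L := Submodule.le_div_iff_mul_le.1 le_rfl
    exact (mul_le_mul' le_rfl h).trans h

/-- If a nonzero (fractional) ideal `I` of `R` is Clifford `*`-regular, then,
with `E := (I^* : I^*)` and `T := I^*(E : I^*)`, the ideal `T` is `v_E`-invertible:
`(E : (E : T)) = E`. -/
theorem trace_vE_invertible_of_clifford_regular
    {R K : Type*} [CommRing R] [IsDomain R] [Field K] [Algebra R K] [IsFractionRing R K]
    (s : StarOperation R K) (I : Submodule R K) (hI : IsFrac R K I) (hreg : s.Regular I) :
    (s.star I / s.star I) /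
        ((s.star I / s.star I) / (s.star I * ((s.star I / s.star I) / s.star I)))
      = s.star I / s.star I := by
  obtain ⟨J, hJ, hIJ⟩ := hreg
  have hL : s.star I / s.star I = s.star I / I := s.star_div_star hI hI
  have hIL : I ≤ s.star I := s.le_star I hI
  have hfrac : IsFrac R K (I * I * J) := (hI.mul hI).mul hJ
  have hIIJ : I * I * J ≤ s.star I := hIJ ▸ s.le_star _ hfrac
  have hJE : J ≤ (s.star I / s.star I) / s.star I := by
    have hJI : J * I ≤ s.star I / s.star I := by
      rw [hL, Submodule.le_div_iff_mul_le]
      exact le_of_eq_of_le (by ring) hIIJ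
    rw [Submodule.le_div_iff_mul_le, hL, Submodule.le_div_iff_mul_le]
    rw [Submodule.le_div_iff_mul_le] at hJI
    exact le_of_eq_of_le (by ring) hJI
  have hE : (s.star I / s.star I) / (s.star I * ((s.star I / s.star I) / s.star I))
      = s.star I / s.star I := by
    set T := s.star I * ((s.star I / s.star I) / s.star I) with hT
    have hTE : T ≤ s.star I / s.star I := by
      rw [hT, mul_comm]
      exact Submodule.le_div_iff_mul_le.1 le_rfl
    have hIJT : I * J ≤ T := mul_le_mul' hIL hJE
    refine le_antisymm ?_ ?_
    · have h : (s.star I / s.star I) / T * (I * J) ≤ s.star I / s.star I :=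
        (mul_le_mul' le_rfl hIJT).trans (Submodule.le_div_iff_mul_le.1 le_rfl)
      rw [hL, Submodule.le_div_iff_mul_le, ← hL] at h
      have h' : (s.star I / s.star I) / T ≤ s.star I / (I * I * J) :=
        Submodule.le_div_iff_mul_le.2 (le_of_eq_of_le (by ring) h)
      rwa [← s.star_div_star hfrac hI, ← hIJ] at h'
    · rw [Submodule.le_div_iff_mul_le]
      refine (mul_le_mul' le_rfl hTE).trans ?_
      exact Submodule.le_div_iff_mul_le.1 (Submodule.div_self_div_self _).ge
  rw [hE, Submodule.div_self_div_self]
end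

section
/- Let R ⊆ D be an extension of integral domains with the same quotient field K. If the extension is locally t-compatible, i.e. for every prime ideal P of R the extension R_P ⊆ D_{R∖P} is t-compatible (that is, (F·D_{R∖P})^{t_{D_{R∖P}}} = (F^{t_{R_P}}·D_{R∖P})^{t_{D_{R∖P}}} for every nonzero R_P-submodule F of K), then the extension R ⊆ D is t-compatible, i.e. (FD)^{t_D} = (F^{t_R}D)^{t_D} for every nonzero R-submodule F of K. -/
open scoped Pointwise

/-- The localization `R_P ⊆ K` of `R` at the prime `P`: the subring of `K` generated by `R`
and the inverses of the elements of `R ∖ P`. -/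
def locAlg (R K : Type*) [CommRing R] [Field K] [Algebra R K] (P : Ideal R) :
    Subalgebra R K :=
  Algebra.adjoin R {y : K | ∃ s : R, s ∉ P ∧ y = (algebraMap R K s)⁻¹}

/-- The localization `D_{R∖P} ⊆ K` of the overring `D` at the multiplicative set `R ∖ P`:
the subring of `K` generated by `D` and the inverses of the elements of `R ∖ P`. -/
def locAlgOver (R K : Type*) [CommRing R] [Field K] [Algebra R K] (D : Subalgebra R K)
    (P : Ideal R) : Subalgebra R K :=
  Algebra.adjoin R ((D : Set K) ∪ {y : K | ∃ s : R, s ∉ P ∧ y = (algebraMap R K s)⁻¹})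

section Closure

variable {A K : Type*} [CommRing A] [Field K] [Algebra A K]

theorem mem_one_div_span_iff {S : Set K} {y : K} :
    y ∈ (1 : Submodule A K) / Submodule.span A S ↔ ∀ s ∈ S, y * s ∈ (1 : Submodule A K) := by
  rw [Submodule.mem_div_iff_forall_mul_mem]
  refine ⟨fun h s hs => h s (Submodule.subset_span hs), fun h z hz => ?_⟩
  induction hz using Submodule.span_induction with
  | mem s hs => exact h s hs
  | zero => simp
  | add a b _ _ ha hb => rw [mul_add]; exact add_mem ha hb
  | smul r a _ ha => rw [mul_smul_comm]; exact Submodule.smul_mem _ r ha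

theorem one_div_antitone {I J : Submodule A K} (h : I ≤ J) :
    (1 : Submodule A K) / J ≤ 1 / I := fun x hx => by
  rw [Submodule.mem_div_iff_forall_mul_mem] at hx ⊢
  exact fun y hy => hx y (h hy)

theorem le_vS (I : Submodule A K) : I ≤ vS A K I := fun x hx => by
  rw [vS, Submodule.mem_div_iff_forall_mul_mem]
  intro y hy
  rw [mul_comm]
  exact (Submodule.mem_div_iff_forall_mul_mem.1 hy) x hx

theorem vS_mono {I J : Submodule A K} (h : I ≤ J) : vS A K I ≤ vS A K J :=
  one_div_antitone (one_div_antitone h)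

theorem vS_vS_le (I : Submodule A K) : vS A K (vS A K I) ≤ vS A K I :=
  one_div_antitone (le_vS (1 / I))

theorem vS_le_tS {I J : Submodule A K} (h0 : J ≠ ⊥) (hfg : J.FG) (h : J ≤ I) :
    vS A K J ≤ tS A K I :=
  le_iSup₂_of_le (f := fun J _ => vS A K J) J ⟨h0, hfg, h⟩ le_rfl

theorem tS_le_vS (I : Submodule A K) : tS A K I ≤ vS A K I :=
  iSup₂_le fun _ hJ => vS_mono hJ.2.2

theorem tS_mono {I J : Submodule A K} (h : I ≤ J) : tS A K I ≤ tS A K J :=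
  iSup₂_le fun _ hH => vS_le_tS hH.1 hH.2.1 (hH.2.2.trans h)

theorem le_tS (I : Submodule A K) : I ≤ tS A K I := fun x hx => by
  by_cases h0 : x = 0
  · exact h0 ▸ zero_mem _
  · have hx' : x ∈ Submodule.span A {x} := Submodule.mem_span_singleton_self x
    refine vS_le_tS (J := Submodule.span A {x}) ?_ (Submodule.fg_span_singleton x)
      ((Submodule.span_singleton_le_iff_mem _ _).2 hx) (le_vS _ hx')
    simpa using h0

theorem exists_fg_of_ne_bot {I : Submodule A K} (h : I ≠ ⊥) :
    ∃ J : Submodule A K, J ≠ ⊥ ∧ J.FG ∧ J ≤ I := by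
  obtain ⟨x, hx, h0⟩ := Submodule.exists_mem_ne_zero_of_ne_bot h
  exact ⟨Submodule.span A {x}, by simpa using h0, Submodule.fg_span_singleton x,
    (Submodule.span_singleton_le_iff_mem _ _).2 hx⟩

theorem exists_mem_vS_of_mem_tS {I : Submodule A K} (h : I ≠ ⊥) {x : K} (hx : x ∈ tS A K I) :
    ∃ J : Submodule A K, (J ≠ ⊥ ∧ J.FG ∧ J ≤ I) ∧ x ∈ vS A K J := by
  obtain ⟨J₀, hJ₀⟩ := exists_fg_of_ne_bot h
  have hx' : x ∈ ⨆ J : {J : Submodule A K | J ≠ ⊥ ∧ J.FG ∧ J ≤ I}, vS A K J.1 := by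
    rwa [iSup_subtype]
  have : Nonempty {J : Submodule A K | J ≠ ⊥ ∧ J.FG ∧ J ≤ I} := ⟨⟨J₀, hJ₀⟩⟩
  rw [Submodule.mem_iSup_of_directed] at hx'
  · obtain ⟨J, hJ⟩ := hx'
    exact ⟨J.1, J.2, hJ⟩
  · rintro ⟨J, hJ⟩ ⟨H, hH⟩
    exact ⟨⟨J ⊔ H, ne_bot_of_le_ne_bot hJ.1 le_sup_left, hJ.2.1.sup hH.2.1,
      sup_le hJ.2.2 hH.2.2⟩, vS_mono le_sup_left, vS_mono le_sup_right⟩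

theorem exists_le_vS_of_fg_le_tS {I : Submodule A K} (h : I ≠ ⊥) {H : Submodule A K}
    (hfg : H.FG) (hH : H ≤ tS A K I) :
    ∃ J : Submodule A K, (J ≠ ⊥ ∧ J.FG ∧ J ≤ I) ∧ H ≤ vS A K J := by
  induction H, hfg using Submodule.fg_induction with
  | singleton x =>
    obtain ⟨J, hJ, hx⟩ := exists_mem_vS_of_mem_tS h (hH (Submodule.mem_span_singleton_self x))
    exact ⟨J, hJ, (Submodule.span_singleton_le_iff_mem _ _).2 hx⟩
  | sup M N _ _ hM hN =>
    obtain ⟨J, hJ, hMJ⟩ := hM (le_sup_left.trans hH)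
    obtain ⟨J', hJ', hNJ⟩ := hN (le_sup_right.trans hH)
    exact ⟨J ⊔ J', ⟨ne_bot_of_le_ne_bot hJ.1 le_sup_left, hJ.2.1.sup hJ'.2.1,
      sup_le hJ.2.2 hJ'.2.2⟩, sup_le (hMJ.trans (vS_mono le_sup_left))
      (hNJ.trans (vS_mono le_sup_right))⟩

theorem tS_tS_le {I : Submodule A K} (h : I ≠ ⊥) : tS A K (tS A K I) ≤ tS A K I :=
  iSup₂_le fun _ hH => by
    obtain ⟨J, hJ, hle⟩ := exists_le_vS_of_fg_le_tS h hH.2.1 hH.2.2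
    exact (vS_mono hle).trans ((vS_vS_le J).trans (vS_le_tS hJ.1 hJ.2.1 hJ.2.2))

end Closure

section Localization

variable {R K : Type*} [CommRing R] [Field K] [Algebra R K]

theorem Subalgebra.mem_one_submodule_iff {B : Subalgebra R K} {x : K} :
    x ∈ (1 : Submodule B K) ↔ x ∈ B := by
  rw [Submodule.mem_one]
  exact ⟨fun ⟨y, hy⟩ => hy ▸ y.2, fun hx => ⟨⟨x, hx⟩, rfl⟩⟩

theorem inv_mem_locAlg {P : Ideal R} {s : R} (hs : s ∉ P) :
    (algebraMap R K s)⁻¹ ∈ locAlg R K P :=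
  Algebra.subset_adjoin ⟨s, hs, rfl⟩

theorem locAlg_le_locAlgOver (D : Subalgebra R K) (P : Ideal R) :
    locAlg R K P ≤ locAlgOver R K D P :=
  Algebra.adjoin_mono Set.subset_union_right

theorem le_locAlgOver (D : Subalgebra R K) (P : Ideal R) : D ≤ locAlgOver R K D P :=
  fun _ hx => Algebra.subset_adjoin (Or.inl hx)

theorem exists_smul_mem_of_mem_locAlgOver {D : Subalgebra R K} {P : Ideal R} (hP : P.IsPrime)
    {z : K} (hz : z ∈ locAlgOver R K D P) : ∃ s : R, s ∉ P ∧ s • z ∈ D := by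
  induction hz using Algebra.adjoin_induction with
  | mem x hx =>
    rcases hx with hx | ⟨s, hs, rfl⟩
    · exact ⟨1, P.ne_top_iff_one.1 hP.ne_top, by simpa using hx⟩
    · refine ⟨s, hs, ?_⟩
      rw [Algebra.smul_def]
      by_cases h0 : algebraMap R K s = 0
      · simp [h0]
      · rw [mul_inv_cancel₀ h0]; exact one_mem D
  | algebraMap r => exact ⟨1, P.ne_top_iff_one.1 hP.ne_top, by simp⟩
  | add x y _ _ hx hy =>
    obtain ⟨s, hs, hsx⟩ := hx
    obtain ⟨t, ht, hty⟩ := hy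
    refine ⟨s * t, hP.mul_notMem hs ht, ?_⟩
    rw [smul_add]
    refine add_mem ?_ ?_
    · rw [mul_comm, mul_smul]; exact D.smul_mem hsx t
    · rw [mul_smul]; exact D.smul_mem hty s
  | mul x y _ _ hx hy =>
    obtain ⟨s, hs, hsx⟩ := hx
    obtain ⟨t, ht, hty⟩ := hy
    refine ⟨s * t, hP.mul_notMem hs ht, ?_⟩
    rw [← smul_mul_smul_comm]
    exact mul_mem hsx hty

theorem exists_smul_mem_of_mem_locAlg {P : Ideal R} (hP : P.IsPrime) {z : K}
    (hz : z ∈ locAlg R K P) : ∃ s : R, s ∉ P ∧ s • z ∈ (1 : Submodule R K) := by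
  obtain ⟨s, hs, h⟩ := exists_smul_mem_of_mem_locAlgOver hP (locAlg_le_locAlgOver ⊥ P hz)
  exact ⟨s, hs, Submodule.mem_one.2 (Algebra.mem_bot.1 h)⟩

/-- An overring is the intersection of its localizations at the primes of the base ring. -/
theorem mem_of_forall_mem_locAlgOver {D : Subalgebra R K} {z : K}
    (h : ∀ P : Ideal R, P.IsPrime → z ∈ locAlgOver R K D P) : z ∈ D := by
  let I : Ideal R := (Subalgebra.toSubmodule D).comap (LinearMap.toSpanSingleton R K z)
  have hI : I = ⊤ := by
    by_contra hne
    obtain ⟨P, hP, hle⟩ := Ideal.exists_le_maximal I hne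
    obtain ⟨s, hs, hsz⟩ := exists_smul_mem_of_mem_locAlgOver hP.isPrime (h P hP.isPrime)
    exact hs (hle hsz)
  have h1 : (1 : R) • z ∈ D := (Ideal.eq_top_iff_one I).1 hI
  rwa [one_smul] at h1

theorem exists_smul_mem_one_div {P : Ideal R} (hP : P.IsPrime) {J : Submodule R K} (hJ : J.FG)
    {z : K} (hz : ∀ j ∈ J, z * j ∈ locAlg R K P) :
    ∃ s : R, s ∉ P ∧ s • z ∈ (1 : Submodule R K) / J := by
  induction J, hJ using Submodule.fg_induction with
  | singleton x =>
    obtain ⟨s, hs, h⟩ := exists_smul_mem_of_mem_locAlg hP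
      (hz x (Submodule.mem_span_singleton_self x))
    refine ⟨s, hs, mem_one_div_span_iff.2 fun y hy => ?_⟩
    rw [Set.mem_singleton_iff.1 hy, smul_mul_assoc]
    exact h
  | sup M N _ _ hM hN =>
    obtain ⟨s, hs, hsM⟩ := hM fun j hj => hz j (Submodule.mem_sup_left hj)
    obtain ⟨t, ht, htN⟩ := hN fun j hj => hz j (Submodule.mem_sup_right hj)
    refine ⟨s * t, hP.mul_notMem hs ht, ?_⟩
    have hM' : (s * t) • z ∈ (1 : Submodule R K) / M := by
      rw [mul_comm, mul_smul]; exact Submodule.smul_mem _ t hsM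
    have hN' : (s * t) • z ∈ (1 : Submodule R K) / N := by
      rw [mul_smul]; exact Submodule.smul_mem _ s htN
    rw [Submodule.mem_div_iff_forall_mul_mem] at hM' hN' ⊢
    intro j hj
    obtain ⟨m, hm, n, hn, rfl⟩ := Submodule.mem_sup.1 hj
    rw [mul_add]
    exact add_mem (hM' m hm) (hN' n hn)

theorem span_fg_of_fg {J : Submodule R K} (hJ : J.FG) (B : Subalgebra R K) :
    (Submodule.span B (J : Set K)).FG := by
  obtain ⟨T, rfl⟩ := hJ
  rw [Submodule.span_span_of_tower]
  exact ⟨T, rfl⟩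

theorem span_ne_bot {J : Submodule R K} (hJ : J ≠ ⊥) (B : Subalgebra R K) :
    Submodule.span B (J : Set K) ≠ ⊥ := by
  obtain ⟨x, hx, h0⟩ := Submodule.exists_mem_ne_zero_of_ne_bot hJ
  exact (Submodule.ne_bot_iff _).2 ⟨x, Submodule.subset_span hx, h0⟩

/-- The divisorial closure of a finitely generated module is contained in that of its
localization. -/
theorem mem_vS_span_locAlg [FaithfulSMul R K] {P : Ideal R} (hP : P.IsPrime)
    {J : Submodule R K} (hJ : J.FG) {x : K} (hx : x ∈ vS R K J) :
    x ∈ vS (locAlg R K P) K (Submodule.span (locAlg R K P) (J : Set K)) := by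
  rw [vS, Submodule.mem_div_iff_forall_mul_mem]
  intro z hz
  rw [mem_one_div_span_iff] at hz
  obtain ⟨s, hs, hsz⟩ := exists_smul_mem_one_div hP hJ
    fun j hj => Subalgebra.mem_one_submodule_iff.1 (hz j hj)
  obtain ⟨r, hr⟩ := Submodule.mem_one.1 ((Submodule.mem_div_iff_forall_mul_mem.1 hx) _ hsz)
  have h0 : algebraMap R K s ≠ 0 := by
    rw [Ne, FaithfulSMul.algebraMap_eq_zero_iff]
    rintro rfl
    exact hs P.zero_mem
  rw [Subalgebra.mem_one_submodule_iff]
  have hxz : x * z = (algebraMap R K s)⁻¹ * algebraMap R K r := by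
    rw [hr, Algebra.smul_def]
    field_simp
  rw [hxz]
  exact mul_mem (inv_mem_locAlg hs) (Subalgebra.algebraMap_mem _ r)

end Localization

/-- Let `R ⊆ D` be an extension of domains with the same quotient field `K`
(so `D` is an overring of `R` inside `K`). If for every prime ideal `P` of `R` the extension
`R_P ⊆ D_{R∖P}` is `t`-compatible, then the extension `R ⊆ D` is `t`-compatible. -/
theorem t_compatible_of_locally_t_compatible
    {R K : Type*} [CommRing R] [IsDomain R] [Field K] [Algebra R K] [IsFractionRing R K]
    (D : Subalgebra R K)
    (hloc : ∀ P : Ideal R, P.IsPrime →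
      ∀ F : Submodule (locAlg R K P) K, F ≠ ⊥ →
        tS (locAlgOver R K D P) K
            (Submodule.span (locAlgOver R K D P) (F : Set K)) =
          tS (locAlgOver R K D P) K
            (Submodule.span (locAlgOver R K D P)
              ((tS (locAlg R K P) K F : Submodule (locAlg R K P) K) : Set K))) :
    ∀ F : Submodule R K, F ≠ ⊥ →
      tS D K (Submodule.span D (F : Set K)) =
        tS D K (Submodule.span D ((tS R K F : Submodule R K) : Set K)) := by
  intro F hF
  refine le_antisymm (tS_mono (Submodule.span_mono (le_tS F)))
    ((tS_mono (Submodule.span_le.2 fun x hx => ?_)).trans (tS_tS_le (span_ne_bot hF D)))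
  obtain ⟨J, ⟨hJ0, hJfg, hJF⟩, hxJ⟩ := exists_mem_vS_of_mem_tS hF hx
  refine vS_le_tS (span_ne_bot hJ0 D) (span_fg_of_fg hJfg D) (Submodule.span_mono hJF) ?_
  rw [vS, Submodule.mem_div_iff_forall_mul_mem]
  intro y hy
  rw [mem_one_div_span_iff] at hy
  refine Subalgebra.mem_one_submodule_iff.2 (mem_of_forall_mem_locAlgOver fun P hP => ?_)
  set G := Submodule.span (locAlg R K P) (J : Set K)
  have hG0 : G ≠ ⊥ := span_ne_bot hJ0 _
  have hxG : x ∈ tS (locAlg R K P) K G :=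
    vS_le_tS hG0 (span_fg_of_fg hJfg _) le_rfl (mem_vS_span_locAlg hP hJfg hxJ)
  have hxG' := le_tS _ (Submodule.subset_span (R := locAlgOver R K D P) hxG)
  rw [← hloc P hP G hG0] at hxG'
  refine Subalgebra.mem_one_submodule_iff.1
    ((Submodule.mem_div_iff_forall_mul_mem.1 (tS_le_vS _ hxG')) y
      (mem_one_div_span_iff.2 fun g hg => Subalgebra.mem_one_submodule_iff.2 ?_))
  have hg' : g ∈ G := hg
  induction hg' using Submodule.span_induction with
  | mem j hj => exact le_locAlgOver D P (Subalgebra.mem_one_submodule_iff.1 (hy j hj))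
  | zero => simp
  | add a b ha hb iha ihb => rw [mul_add]; exact add_mem (iha ha) (ihb hb)
  | smul r a ha iha =>
    rw [Algebra.smul_def, mul_left_comm]
    exact mul_mem (locAlg_le_locAlgOver D P r.2) (iha ha)
end
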